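/- arXiv:1905.04273 — 2 statements merged into one kernel-verified Lean document; each statement's English description precedes it below -/
import Mathlib

section
/- Fix ε, δ > 0, a restriction parameter Δ ≥ 1, integers k ≤ k̄ < d, and Δ-restricted-sensitivity neighboring histograms h, h' : Fin d → ℕ. Let S be the set of outputs of prEM_{k,k̄}(h, D_{k̄}(h)) having positive probability, S' the analogous set for h', and S^δ = S \ S'. Then Pr[ prEM_{k,k̄}(h, D_{k̄}(h)) ∈ S^δ ] ≤ δ. -/
open scoped BigOperators

/-- The `k`-th largest value among the entries of the histogram `h`. -/
noncomputable def kthLargest {d : ℕ} (h : Fin d → ℕ) (k : ℕ) : ℕ :=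
  sSup {v | k ≤ (Finset.univ.filter fun i => v ≤ h i).card}

/-- Histograms are neighboring if one user's data is added or removed. -/
def Neighbors {d : ℕ} (h h' : Fin d → ℕ) : Prop :=
  (∀ i, h' i ≤ h i ∧ h i ≤ h' i + 1) ∨ (∀ i, h i ≤ h' i ∧ h' i ≤ h i + 1)

/-- `Δ`-restricted-sensitivity neighbors. -/
def RestrictedNeighbors {d : ℕ} (Δ : ℕ) (h h' : Fin d → ℕ) : Prop :=
  Neighbors h h' ∧ (Finset.univ.filter fun i => h i ≠ h' i).card ≤ Δ

/-- The rank of index `i` in the ordering of `h` by decreasing count, ties toward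
smaller indices. -/
def histRank {d : ℕ} (h : Fin d → ℕ) (i : Fin d) : ℕ :=
  (Finset.univ.filter fun j => h i < h j ∨ (h j = h i ∧ j < i)).card

/-- The limited domain `D_k(h)`: the indices of the `k` largest entries of `h`. -/
def limitedDomain {d : ℕ} (h : Fin d → ℕ) (k : ℕ) : Finset (Fin d) :=
  Finset.univ.filter fun i => histRank h i < k

/-- The count `h_⊥ = h_{(k̄+1)} + 1 + ln(min{Δ,k̄}/δ)/ε` assigned to `⊥`. -/
noncomputable def hBot {d : ℕ} (ε δ : ℝ) (Δ kbar : ℕ) (h : Fin d → ℕ) : ℝ :=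
  (kthLargest h (kbar + 1) : ℝ) + 1 + Real.log ((min Δ kbar : ℕ) / δ) / ε

/-- Exponential-mechanism weight of an outcome in `Fin d ∪ {⊥}` (with `⊥ = none`). -/
noncomputable def emWeight {d : ℕ} (ε δ : ℝ) (Δ kbar : ℕ) (h : Fin d → ℕ) :
    Option (Fin d) → ℝ
  | some i => Real.exp (ε * (h i : ℝ))
  | none => Real.exp (ε * hBot ε δ Δ kbar h)

/-- The limited histogram exponential mechanism `ĥEM(h, D)`: probability of outcome `o`
in `D ∪ {⊥}` proportional to its weight. -/
noncomputable def stepProb {d : ℕ} (ε δ : ℝ) (Δ kbar : ℕ) (h : Fin d → ℕ)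
    (D : Finset (Fin d)) (o : Option (Fin d)) : ℝ :=
  emWeight ε δ Δ kbar h o /
    (emWeight ε δ Δ kbar h none + ∑ j ∈ D, emWeight ε δ Δ kbar h (some j))

/-- `prEMProb ε δ Δ kbar h k D l` is the probability that the peeling mechanism
`prEM_{k,k̄}(h, D)` outputs exactly the ordered list `l` (with `⊥ = none`). -/
noncomputable def prEMProb {d : ℕ} (ε δ : ℝ) (Δ kbar : ℕ) (h : Fin d → ℕ) :
    ℕ → Finset (Fin d) → List (Option (Fin d)) → ℝ
  | 0, _, l => if l = [] then 1 else 0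
  | _ + 1, D, [none] => stepProb ε δ Δ kbar h D none
  | k + 1, D, some i :: rest =>
      if i ∈ D then
        stepProb ε δ Δ kbar h D (some i) * prEMProb ε δ Δ kbar h k (D.erase i) rest
      else 0
  | _ + 1, _, _ => 0

/-- Index `i` precedes `j` in the ordering used to define `histRank`. -/
def HistPrec {d : ℕ} (h : Fin d → ℕ) (i j : Fin d) : Prop :=
  h j < h i ∨ (h i = h j ∧ i < j)

lemma histPrec_trichotomous {d : ℕ} (h : Fin d → ℕ) (i j : Fin d) :
    HistPrec h i j ∨ i = j ∨ HistPrec h j i := by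
  unfold HistPrec
  rcases lt_trichotomy (h i) (h j) with h1 | h1 | h1 <;>
  rcases lt_trichotomy i j with h2 | h2 | h2 <;> simp [*]

lemma histRank_lt_of_histPrec {d : ℕ} (h : Fin d → ℕ) {i j : Fin d} (hij : HistPrec h i j) :
    histRank h i < histRank h j := by
  unfold HistPrec at hij
  refine Finset.card_lt_card ((Finset.ssubset_iff_of_subset fun l hl => ?_).2 ⟨i, ?_, ?_⟩)
  · simp only [Finset.mem_filter, Finset.mem_univ, true_and] at hl ⊢
    grind
  · simpa using hij
  · simp

lemma histRank_injective {d : ℕ} (h : Fin d → ℕ) : Function.Injective (histRank h) := by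
  intro i j hij
  rcases histPrec_trichotomous h i j with h1 | h1 | h1
  · exact absurd hij (histRank_lt_of_histPrec h h1).ne
  · exact h1
  · exact absurd hij (histRank_lt_of_histPrec h h1).ne'

lemma histRank_lt {d : ℕ} (h : Fin d → ℕ) (i : Fin d) : histRank h i < d := by
  calc histRank h i < (Finset.univ : Finset (Fin d)).card :=
        Finset.card_lt_card ((Finset.ssubset_iff_of_subset (Finset.filter_subset _ _)).2
          ⟨i, Finset.mem_univ i, by simp⟩)
    _ = d := by simp

lemma card_limitedDomain {d : ℕ} (h : Fin d → ℕ) {k : ℕ} (hk : k ≤ d) :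
    (limitedDomain h k).card = k := by
  have hinj : Function.Injective fun i : Fin d => (⟨histRank h i, histRank_lt h i⟩ : Fin d) :=
    fun i j hij => histRank_injective h (Fin.mk.inj hij)
  have hsurj := Finite.surjective_of_injective hinj
  have himage : (limitedDomain h k).image (histRank h) = Finset.range k := by
    ext v
    simp only [limitedDomain, Finset.mem_image, Finset.mem_filter, Finset.mem_univ, true_and,
      Finset.mem_range]
    constructor
    · rintro ⟨i, hi, rfl⟩
      exact hi
    · intro hv
      obtain ⟨i, hi⟩ := hsurj ⟨v, hv.trans_le hk⟩
      have hi' : histRank h i = v := Fin.mk.inj hi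
      exact ⟨i, hi' ▸ hv, hi'⟩
  rw [← Finset.card_image_of_injective _ (histRank_injective h), himage, Finset.card_range]

lemma histPrec_of_mem_of_notMem {d : ℕ} {h : Fin d → ℕ} {k : ℕ} {i j : Fin d}
    (hi : i ∈ limitedDomain h k) (hj : j ∉ limitedDomain h k) : HistPrec h i j := by
  simp only [limitedDomain, Finset.mem_filter, Finset.mem_univ, true_and, not_lt] at hi hj
  rcases histPrec_trichotomous h i j with h1 | rfl | h1
  · exact h1
  · omega
  · have := histRank_lt_of_histPrec h h1
    omega

lemma le_kthLargest_of_notMem {d : ℕ} {h : Fin d → ℕ} {k : ℕ} {j : Fin d}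
    (hj : j ∉ limitedDomain h k) : h j ≤ kthLargest h (k + 1) := by
  simp only [limitedDomain, Finset.mem_filter, Finset.mem_univ, true_and, not_lt] at hj
  refine le_csSup ⟨∑ i, h i, fun v hv => ?_⟩ ?_
  · have hpos : 0 < (Finset.univ.filter fun i => v ≤ h i).card := (Nat.succ_pos k).trans_le hv
    obtain ⟨i, hi⟩ := Finset.card_pos.1 hpos
    exact (Finset.mem_filter.1 hi).2.trans
      (Finset.single_le_sum (fun _ _ => Nat.zero_le _) (Finset.mem_univ i))
  · refine (Nat.succ_le_succ hj).trans (Nat.succ_le_of_lt (Finset.card_lt_card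
      ((Finset.ssubset_iff_of_subset fun l hl => ?_).2 ⟨j, by simp, by simp⟩)))
    simp only [Finset.mem_filter, Finset.mem_univ, true_and] at hl ⊢
    omega

lemma card_limitedDomain_sdiff_comm {d : ℕ} (h h' : Fin d → ℕ) {k : ℕ} (hk : k ≤ d) :
    (limitedDomain h k \ limitedDomain h' k).card =
      (limitedDomain h' k \ limitedDomain h k).card :=
  Finset.card_sdiff_comm ((card_limitedDomain h hk).trans (card_limitedDomain h' hk).symm)

lemma exists_mem_limitedDomain_sdiff {d : ℕ} {h h' : Fin d → ℕ} {k : ℕ} (hk : k ≤ d)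
    {i : Fin d} (hi : i ∈ limitedDomain h k \ limitedDomain h' k) :
    ∃ j ∈ limitedDomain h' k \ limitedDomain h k, HistPrec h i j ∧ HistPrec h' j i := by
  have hpos := Finset.card_pos.2 ⟨i, hi⟩
  rw [card_limitedDomain_sdiff_comm h h' hk] at hpos
  obtain ⟨j, hj⟩ := Finset.card_pos.1 hpos
  have hi' := Finset.mem_sdiff.1 hi
  have hj' := Finset.mem_sdiff.1 hj
  exact ⟨j, hj, histPrec_of_mem_of_notMem hi'.1 hj'.2, histPrec_of_mem_of_notMem hj'.1 hi'.2⟩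

lemma card_limitedDomain_sdiff_le_of_le {d : ℕ} {h h' : Fin d → ℕ} {k : ℕ} (hk : k ≤ d)
    (hle : ∀ i, h' i ≤ h i) :
    (limitedDomain h k \ limitedDomain h' k).card ≤
      (Finset.univ.filter fun i => h i ≠ h' i).card := by
  refine Finset.card_le_card fun i hi => ?_
  obtain ⟨j, -, h1, h2⟩ := exists_mem_limitedDomain_sdiff hk hi
  have := hle i
  have := hle j
  simp only [Finset.mem_filter, Finset.mem_univ, true_and]
  unfold HistPrec at h1 h2
  omega

lemma card_limitedDomain_sdiff_le {d : ℕ} {h h' : Fin d → ℕ} {Δ k : ℕ} (hk : k ≤ d)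
    (hnb : RestrictedNeighbors Δ h h') :
    (limitedDomain h k \ limitedDomain h' k).card ≤ min Δ k := by
  refine le_min (le_trans ?_ hnb.2)
    ((Finset.card_le_card Finset.sdiff_subset).trans (card_limitedDomain h hk).le)
  rcases hnb.1 with hle | hle
  · exact card_limitedDomain_sdiff_le_of_le hk fun i => (hle i).1
  · rw [card_limitedDomain_sdiff_comm h h' hk]
    simpa only [ne_comm] using card_limitedDomain_sdiff_le_of_le (h := h') (h' := h) hk
      fun i => (hle i).1

lemma le_kthLargest_add_one_of_mem_sdiff {d : ℕ} {h h' : Fin d → ℕ} {k : ℕ} (hk : k ≤ d)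
    (hnb : Neighbors h h') {i : Fin d} (hi : i ∈ limitedDomain h k \ limitedDomain h' k) :
    h i ≤ kthLargest h (k + 1) + 1 := by
  obtain ⟨j, hj, -, h2⟩ := exists_mem_limitedDomain_sdiff hk hi
  have hjk := le_kthLargest_of_notMem (Finset.mem_sdiff.1 hj).2
  unfold HistPrec at h2
  rcases hnb with hle | hle <;> have := hle i <;> have := hle j <;> omega

lemma emWeight_pos {d : ℕ} (ε δ : ℝ) (Δ kbar : ℕ) (h : Fin d → ℕ) (o : Option (Fin d)) :
    0 < emWeight ε δ Δ kbar h o := by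
  cases o <;> exact Real.exp_pos _

lemma emWeight_some_le {d : ℕ} {ε δ : ℝ} (hε : 0 < ε) (hδ : 0 < δ) {Δ kbar : ℕ}
    (hmin : 0 < min Δ kbar) {h : Fin d → ℕ} {i : Fin d}
    (hi : h i ≤ kthLargest h (kbar + 1) + 1) :
    emWeight ε δ Δ kbar h (some i) ≤
      δ / (min Δ kbar : ℕ) * emWeight ε δ Δ kbar h none := by
  have hm : (0 : ℝ) < (min Δ kbar : ℕ) := Nat.cast_pos.2 hmin
  have hi' : (h i : ℝ) ≤ kthLargest h (kbar + 1) + 1 := by exact_mod_cast hi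
  have hexp : ε * hBot ε δ Δ kbar h =
      ε * (kthLargest h (kbar + 1) + 1) + Real.log ((min Δ kbar : ℕ) / δ) := by
    unfold hBot
    field_simp
  simp only [emWeight]
  rw [hexp, Real.exp_add, Real.exp_log (div_pos hm hδ)]
  calc Real.exp (ε * h i) ≤ Real.exp (ε * (kthLargest h (kbar + 1) + 1)) := by gcongr
    _ = _ := by field_simp

lemma stepProb_denom_pos {d : ℕ} (ε δ : ℝ) (Δ kbar : ℕ) (h : Fin d → ℕ) (D : Finset (Fin d)) :
    0 < emWeight ε δ Δ kbar h none + ∑ j ∈ D, emWeight ε δ Δ kbar h (some j) :=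
  add_pos_of_pos_of_nonneg (emWeight_pos _ _ _ _ _ _)
    (Finset.sum_nonneg fun _ _ => (emWeight_pos _ _ _ _ _ _).le)

lemma stepProb_pos {d : ℕ} (ε δ : ℝ) (Δ kbar : ℕ) (h : Fin d → ℕ) (D : Finset (Fin d))
    (o : Option (Fin d)) : 0 < stepProb ε δ Δ kbar h D o :=
  div_pos (emWeight_pos _ _ _ _ _ _) (stepProb_denom_pos _ _ _ _ _ _)

lemma prEMProb_pos_of_forall_mem {d : ℕ} {ε δ : ℝ} {Δ kbar : ℕ} {h h' : Fin d → ℕ} {k : ℕ}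
    {D D' : Finset (Fin d)} {l : List (Option (Fin d))}
    (hl : 0 < prEMProb ε δ Δ kbar h k D l) (hmem : ∀ i ∈ D, some i ∈ l → i ∈ D') :
    0 < prEMProb ε δ Δ kbar h' k D' l := by
  induction k generalizing D D' l with
  | zero => simpa [prEMProb] using hl
  | succ k ih =>
    match l with
    | [] => simp [prEMProb] at hl
    | [none] => exact stepProb_pos _ _ _ _ _ _ _
    | none :: _ :: _ => simp [prEMProb] at hl
    | some i :: rest =>
      simp only [prEMProb] at hl ⊢
      split_ifs at hl with hi
      · rw [if_pos (hmem i hi (by simp))]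
        refine mul_pos (stepProb_pos _ _ _ _ _ _ _)
          (ih (pos_of_mul_pos_right hl (stepProb_pos _ _ _ _ _ _ _).le) fun j hj hjl => ?_)
        have hj' := Finset.mem_erase.1 hj
        exact Finset.mem_erase.2 ⟨hj'.1, hmem j hj'.2 (List.mem_cons_of_mem _ hjl)⟩
      · exact absurd hl (lt_irrefl 0)

lemma sum_prEMProb_succ {d : ℕ} (ε δ : ℝ) (Δ kbar : ℕ) (h : Fin d → ℕ) (k : ℕ)
    (D : Finset (Fin d)) (F : Finset (List (Option (Fin d)))) :
    ∑ l ∈ F, prEMProb ε δ Δ kbar h (k + 1) D l =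
      (if [none] ∈ F then stepProb ε δ Δ kbar h D none else 0) +
      ∑ i ∈ D, stepProb ε δ Δ kbar h D (some i) *
        ∑ r ∈ F.preimage (List.cons (some i)) List.cons_injective.injOn,
          prEMProb ε δ Δ kbar h k (D.erase i) r := by
  have hpt : ∀ l ∈ F, prEMProb ε δ Δ kbar h (k + 1) D l =
      (if l = [none] then stepProb ε δ Δ kbar h D none else 0) +
      ∑ i ∈ D, ∑ r ∈ F.preimage (List.cons (some i)) List.cons_injective.injOn,
        if l = some i :: r then
          stepProb ε δ Δ kbar h D (some i) * prEMProb ε δ Δ kbar h k (D.erase i) r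
        else 0 := by
    intro l hl
    match l with
    | [] => simp [prEMProb]
    | [none] => simp [prEMProb]
    | none :: _ :: _ => simp [prEMProb]
    | some i :: rest =>
      have hinner : ∀ j ∈ D, (∑ r ∈ F.preimage (List.cons (some j)) List.cons_injective.injOn,
          if some i :: rest = some j :: r then
            stepProb ε δ Δ kbar h D (some j) * prEMProb ε δ Δ kbar h k (D.erase j) r
          else 0) = if i = j then
            stepProb ε δ Δ kbar h D (some i) * prEMProb ε δ Δ kbar h k (D.erase i) rest
          else 0 := by
        intro j _
        by_cases hij : i = j
        · subst hij
          simp [hl]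
        · simp [hij]
      rw [Finset.sum_congr rfl hinner]
      simp [prEMProb]
  rw [Finset.sum_congr rfl hpt, Finset.sum_add_distrib, Finset.sum_ite_eq', Finset.sum_comm]
  congr 1
  refine Finset.sum_congr rfl fun i _ => ?_
  rw [Finset.sum_comm, Finset.mul_sum]
  refine Finset.sum_congr rfl fun r hr => ?_
  rw [Finset.sum_ite_eq', if_pos (Finset.mem_preimage.1 hr)]

lemma sum_prEMProb_le_one {d : ℕ} (ε δ : ℝ) (Δ kbar : ℕ) (h : Fin d → ℕ) (k : ℕ)
    (D : Finset (Fin d)) (F : Finset (List (Option (Fin d)))) :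
    ∑ l ∈ F, prEMProb ε δ Δ kbar h k D l ≤ 1 := by
  induction k generalizing D F with
  | zero =>
    simp only [prEMProb, Finset.sum_ite_eq']
    split_ifs <;> norm_num
  | succ k ih =>
    rw [sum_prEMProb_succ]
    calc _ ≤ stepProb ε δ Δ kbar h D none + ∑ i ∈ D, stepProb ε δ Δ kbar h D (some i) * 1 := by
          refine add_le_add ?_ (Finset.sum_le_sum fun i _ =>
            mul_le_mul_of_nonneg_left (ih _ _) (stepProb_pos _ _ _ _ _ _ _).le)
          split_ifs
          · exact le_rfl
          · exact (stepProb_pos _ _ _ _ _ _ _).le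
      _ = 1 := by
          simp only [mul_one, stepProb]
          rw [← Finset.sum_div, ← add_div, div_self (stepProb_denom_pos _ _ _ _ _ _).ne']

/-- The peeling mechanism outputs an element of `B` with probability at most
`w(D ∩ B) / (w(D ∩ B) + w(⊥))`, where `w` is the weight of the exponential mechanism. -/
lemma sum_prEMProb_hit_le {d : ℕ} (ε δ : ℝ) (Δ kbar : ℕ) (h : Fin d → ℕ) (k : ℕ)
    (D B : Finset (Fin d)) (F : Finset (List (Option (Fin d))))
    (hF : ∀ l ∈ F, ∃ i ∈ B, some i ∈ l) :
    ∑ l ∈ F, prEMProb ε δ Δ kbar h k D l ≤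
      (∑ i ∈ D with i ∈ B, emWeight ε δ Δ kbar h (some i)) /
        ((∑ i ∈ D with i ∈ B, emWeight ε δ Δ kbar h (some i)) + emWeight ε δ Δ kbar h none) := by
  induction k generalizing D F with
  | zero =>
    have hnil : [] ∉ F := fun hl => by
      obtain ⟨i, -, hi⟩ := hF _ hl
      simp at hi
    simp only [prEMProb, Finset.sum_ite_eq', if_neg hnil]
    have hA : 0 ≤ ∑ i ∈ D with i ∈ B, emWeight ε δ Δ kbar h (some i) :=
      Finset.sum_nonneg fun _ _ => (emWeight_pos _ _ _ _ _ _).le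
    exact div_nonneg hA (add_nonneg hA (emWeight_pos _ _ _ _ _ _).le)
  | succ k ih =>
    have hnone : [none] ∉ F := fun hl => by
      obtain ⟨i, -, hi⟩ := hF _ hl
      simp at hi
    rw [sum_prEMProb_succ, if_neg hnone, zero_add]
    set c := emWeight ε δ Δ kbar h none with hc
    set a := ∑ i ∈ D with i ∈ B, emWeight ε δ Δ kbar h (some i) with ha
    set b := ∑ i ∈ D with i ∉ B, emWeight ε δ Δ kbar h (some i) with hb
    have hcpos : 0 < c := emWeight_pos _ _ _ _ _ _
    have ha0 : 0 ≤ a := Finset.sum_nonneg fun _ _ => (emWeight_pos _ _ _ _ _ _).le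
    have hb0 : 0 ≤ b := Finset.sum_nonneg fun _ _ => (emWeight_pos _ _ _ _ _ _).le
    have hab : ∑ i ∈ D, emWeight ε δ Δ kbar h (some i) = a + b :=
      (Finset.sum_filter_add_sum_filter_not D (· ∈ B) _).symm
    rw [← Finset.sum_filter_add_sum_filter_not D (· ∈ B)]
    have hhit : ∑ i ∈ D with i ∈ B, stepProb ε δ Δ kbar h D (some i) *
        ∑ r ∈ F.preimage (List.cons (some i)) List.cons_injective.injOn,
          prEMProb ε δ Δ kbar h k (D.erase i) r ≤ a / (c + (a + b)) := by
      calc _ ≤ ∑ i ∈ D with i ∈ B, stepProb ε δ Δ kbar h D (some i) * 1 :=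
            Finset.sum_le_sum fun i _ => mul_le_mul_of_nonneg_left
              (sum_prEMProb_le_one _ _ _ _ _ _ _ _) (stepProb_pos _ _ _ _ _ _ _).le
        _ = a / (c + (a + b)) := by
            simp only [mul_one, stepProb]
            rw [← Finset.sum_div, hab]
    have hmiss : ∑ i ∈ D with i ∉ B, stepProb ε δ Δ kbar h D (some i) *
        ∑ r ∈ F.preimage (List.cons (some i)) List.cons_injective.injOn,
          prEMProb ε δ Δ kbar h k (D.erase i) r ≤ b / (c + (a + b)) * (a / (a + c)) := by
      calc _ ≤ ∑ i ∈ D with i ∉ B, stepProb ε δ Δ kbar h D (some i) * (a / (a + c)) := by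
            refine Finset.sum_le_sum fun i hi => mul_le_mul_of_nonneg_left ?_
              (stepProb_pos _ _ _ _ _ _ _).le
            have hiB : i ∉ B := (Finset.mem_filter.1 hi).2
            have herase : (D.erase i).filter (· ∈ B) = D.filter (· ∈ B) := by
              rw [Finset.filter_erase, Finset.erase_eq_of_notMem (by simp [hiB])]
            refine (ih (D.erase i) _ fun r hr => ?_).trans_eq (by rw [herase])
            obtain ⟨j, hjB, hj⟩ := hF _ (Finset.mem_preimage.1 hr)
            refine ⟨j, hjB, (List.mem_cons.1 hj).resolve_left fun hji => hiB ?_⟩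
            exact Option.some.inj hji ▸ hjB
        _ = _ := by
            rw [← Finset.sum_mul]
            simp only [stepProb]
            rw [← Finset.sum_div, hab]
    refine (add_le_add hhit hmiss).trans_eq ?_
    have h1 : c + (a + b) ≠ 0 := by positivity
    have h2 : a + c ≠ 0 := by positivity
    field_simp
    ring

lemma sum_emWeight_le {d : ℕ} {ε δ : ℝ} (hε : 0 < ε) (hδ : 0 < δ) {Δ kbar : ℕ}
    {h : Fin d → ℕ} {B : Finset (Fin d)} (hcard : B.card ≤ min Δ kbar)
    (hB : ∀ i ∈ B, h i ≤ kthLargest h (kbar + 1) + 1) :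
    ∑ i ∈ B, emWeight ε δ Δ kbar h (some i) ≤ δ * emWeight ε δ Δ kbar h none := by
  have hc := emWeight_pos ε δ Δ kbar h none
  rcases B.eq_empty_or_nonempty with rfl | hne
  · simpa using (mul_pos hδ hc).le
  have hmin : 0 < min Δ kbar := (Finset.card_pos.2 hne).trans_le hcard
  have hm : (0 : ℝ) < (min Δ kbar : ℕ) := Nat.cast_pos.2 hmin
  calc _ ≤ B.card • (δ / (min Δ kbar : ℕ) * emWeight ε δ Δ kbar h none) :=
        Finset.sum_le_card_nsmul _ _ _ fun i hi => emWeight_some_le hε hδ hmin (hB i hi)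
    _ ≤ (min Δ kbar : ℕ) * (δ / (min Δ kbar : ℕ) * emWeight ε δ Δ kbar h none) := by
        rw [nsmul_eq_mul]
        gcongr
    _ = _ := by field_simp

/-- Lemma 12: the probability that `prEM_{k,k̄}(h, D_{k̄}(h))` outputs an outcome that is
possible for `h` but impossible for the neighboring histogram `h'` is at most `δ`. -/
theorem stmt_8 (d : ℕ) (ε δ : ℝ) (hε : 0 < ε) (hδ : 0 < δ) (Δ : ℕ) (hΔ : 1 ≤ Δ)
    (k kbar : ℕ) (hkk : k ≤ kbar) (hkd : kbar < d)
    (h h' : Fin d → ℕ) (hnb : RestrictedNeighbors Δ h h') :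
    ∑' l : {l : List (Option (Fin d)) //
        0 < prEMProb ε δ Δ kbar h k (limitedDomain h kbar) l ∧
        ¬ 0 < prEMProb ε δ Δ kbar h' k (limitedDomain h' kbar) l},
      prEMProb ε δ Δ kbar h k (limitedDomain h kbar) (l : List (Option (Fin d))) ≤ δ := by
  have hd : kbar ≤ d := hkd.le
  set B := limitedDomain h kbar \ limitedDomain h' kbar with hB
  refine tsum_le_of_sum_le' hδ.le fun s => ?_
  refine (Finset.sum_map s (Function.Embedding.subtype _)
    fun l => prEMProb ε δ Δ kbar h k (limitedDomain h kbar) l).ge.trans ?_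
  refine (sum_prEMProb_hit_le ε δ Δ kbar h k (limitedDomain h kbar) B _ fun l hl => ?_).trans ?_
  · obtain ⟨⟨l, hpos, hnpos⟩, -, rfl⟩ := Finset.mem_map.1 hl
    by_contra! hmiss
    refine hnpos (prEMProb_pos_of_forall_mem hpos fun i hi hil => ?_)
    by_contra hi'
    exact hmiss i (Finset.mem_sdiff.2 ⟨hi, hi'⟩) hil
  · have hc := emWeight_pos ε δ Δ kbar h none
    have hfilter : (limitedDomain h kbar).filter (· ∈ B) = B := by
      ext i
      simp [hB]
    rw [hfilter]
    have ha : 0 ≤ ∑ i ∈ B, emWeight ε δ Δ kbar h (some i) :=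
      Finset.sum_nonneg fun _ _ => (emWeight_pos _ _ _ _ _ _).le
    rw [div_le_iff₀ (by positivity)]
    have hle := sum_emWeight_le hε hδ (card_limitedDomain_sdiff_le hd hnb)
      fun i hi => le_kthLargest_add_one_of_mem_sdiff hd hnb.1 hi
    nlinarith [mul_nonneg hδ.le ha]
end

section
/- Let h, h' : Fin d → ℕ be neighboring histograms and fix k < d. Define the strictly limited domain D>_k(h) = { i : h(i) > h_{(k+1)} } and similarly D>_k(h'). Then one of the following holds: (1) D>_k(h') ⊆ D>_k(h) and every i ∈ D>_k(h) \ D>_k(h') satisfies h(i) = h_{(k+1)} + 1; or (2) D>_k(h) ⊆ D>_k(h') and every i ∈ D>_k(h') \ D>_k(h) satisfies h'(i) = h'_{(k+1)} + 1. -/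
/-- The strictly limited domain `D>_k(h)`: indices whose count strictly exceeds the
`(k+1)`-th largest count. -/
noncomputable def strictDomain {d : ℕ} (h : Fin d → ℕ) (k : ℕ) : Finset (Fin d) :=
  Finset.univ.filter fun i => kthLargest h (k + 1) < h i

theorem bddAbove_setOf_le_card {d : ℕ} (h : Fin d → ℕ) {k : ℕ} (hk : 0 < k) :
    BddAbove {v | k ≤ (Finset.univ.filter fun i => v ≤ h i).card} := by
  refine ⟨Finset.univ.sup h, fun v hv => ?_⟩
  obtain ⟨i, hi⟩ := Finset.card_pos.mp (hk.trans_le hv)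
  exact (Finset.mem_filter.mp hi).2.trans (Finset.le_sup (Finset.mem_univ i))

theorem kthLargest_le_add {d : ℕ} {h g : Fin d → ℕ} {k c : ℕ} (hk : 0 < k) (hkd : k ≤ d)
    (hle : ∀ i, h i ≤ g i + c) : kthLargest h k ≤ kthLargest g k + c := by
  refine csSup_le ⟨0, by simpa using hkd⟩ fun v hv => ?_
  rw [← Nat.sub_le_iff_le_add]
  refine le_csSup (bddAbove_setOf_le_card g hk) (le_trans (Set.mem_ofPred.mp hv) ?_)
  refine Finset.card_le_card (Finset.monotone_filter_right _ fun i _ hi => ?_)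
  exact Nat.sub_le_iff_le_add.mpr (le_trans hi (hle i))

theorem strictDomain_subset_or_of_le {d : ℕ} {h h' : Fin d → ℕ} {k : ℕ} (hkd : k < d)
    (hle : ∀ i, h' i ≤ h i ∧ h i ≤ h' i + 1) :
    (strictDomain h' k ⊆ strictDomain h k ∧
      ∀ i ∈ strictDomain h k \ strictDomain h' k, h i = kthLargest h (k + 1) + 1) ∨
    (strictDomain h k ⊆ strictDomain h' k ∧
      ∀ i ∈ strictDomain h' k \ strictDomain h k, h' i = kthLargest h' (k + 1) + 1) := by
  have lower : kthLargest h' (k + 1) ≤ kthLargest h (k + 1) :=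
    kthLargest_le_add (c := 0) k.succ_pos hkd fun i => (hle i).1
  have upper : kthLargest h (k + 1) ≤ kthLargest h' (k + 1) + 1 :=
    kthLargest_le_add k.succ_pos hkd fun i => (hle i).2
  simp only [strictDomain, Finset.subset_iff, Finset.mem_sdiff, Finset.mem_filter,
    Finset.mem_univ, true_and]
  rcases lower.eq_or_lt with heq | hlt
  · exact Or.inl ⟨fun i hi => by have := hle i; omega, fun i hi => by have := hle i; omega⟩
  · exact Or.inr ⟨fun i hi => by have := hle i; omega, fun i hi => by have := hle i; omega⟩

/-- Lemma 17: for neighboring histograms, one strictly limited domain contains the other,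
and any index in the difference has count exactly one above the `(k+1)`-th largest count. -/
theorem stmt_16 (d : ℕ) (h h' : Fin d → ℕ) (hnb : Neighbors h h') (k : ℕ) (hkd : k < d) :
    (strictDomain h' k ⊆ strictDomain h k ∧
      ∀ i ∈ strictDomain h k \ strictDomain h' k, h i = kthLargest h (k + 1) + 1) ∨
    (strictDomain h k ⊆ strictDomain h' k ∧
      ∀ i ∈ strictDomain h' k \ strictDomain h k, h' i = kthLargest h' (k + 1) + 1) := by
  rcases hnb with hle | hle
  · exact strictDomain_subset_or_of_le hkd hle
  · exact (strictDomain_subset_or_of_le hkd hle).symm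
end
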